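/- Let 𝔤 be a real Lie algebra, L ⊆ 𝔤 an abelian Lie subalgebra, and L₀ ⊆ L a vector subspace such that: for every x ∈ 𝔤 and v ∈ L ∖ L₀, [x,v] = 0 implies x ∈ L. Let α: L → ℝ be a linear functional with α ≢ 0 and α|_{L₀} ≡ 0. Define ζ: 𝔤 → ℝ by ζ(x) = α(x) if x ∈ L and ζ(x) = 0 if x ∉ L. Then ζ is a Lie quasi-state on 𝔤. -/

import Mathlib

/-- A Lie quasi-state on a real Lie algebra: a function which is linear on every pair of
commuting elements. -/
def IsLieQuasiState {L : Type*} [LieRing L] [LieAlgebra ℝ L] (ζ : L → ℝ) : Prop :=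
  ∀ x y : L, ⁅x, y⁆ = 0 → ∀ c₁ c₂ : ℝ, ζ (c₁ • x + c₂ • y) = c₁ * ζ x + c₂ * ζ y

open Classical in
/-- Let `L` be an abelian subalgebra of a real Lie algebra `𝔤` and `L₀ ⊆ L` a subspace such
that any `x ∈ 𝔤` commuting with some `v ∈ L ∖ L₀` lies in `L`.  If `α` is a linear functional
on `L` (here: on `𝔤`, only its values on `L` matter), nonzero on `L` and vanishing on `L₀`,
then `ζ(x) = α(x)` for `x ∈ L`, `ζ(x) = 0` otherwise, is a Lie quasi-state on `𝔤`. -/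
theorem stmt18 {𝔤 : Type*} [LieRing 𝔤] [LieAlgebra ℝ 𝔤]
    (L : LieSubalgebra ℝ 𝔤)
    (habelian : ∀ u ∈ L, ∀ v ∈ L, ⁅u, v⁆ = 0)
    (L₀ : Submodule ℝ 𝔤) (hL₀ : L₀ ≤ L.toSubmodule)
    (hcond : ∀ x : 𝔤, ∀ v : 𝔤, v ∈ L → v ∉ L₀ → ⁅x, v⁆ = 0 → x ∈ L)
    (α : 𝔤 →ₗ[ℝ] ℝ)
    (hαne : ∃ v ∈ L, α v ≠ 0)
    (hα0 : ∀ v ∈ L₀, α v = 0) :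
    IsLieQuasiState (fun x : 𝔤 => if x ∈ L then α x else 0) := by
  have hzero : ∀ w u : 𝔤, w ∉ L → ⁅w, u⁆ = 0 → (if u ∈ L then α u else 0) = 0 := by
    intro w u hw hwu
    split_ifs with hu
    · by_contra hαu
      exact hw (hcond w u hu (fun h => hαu (hα0 u h)) hwu)
    · rfl
  intro x y hxy c₁ c₂
  have hyx : ⁅y, x⁆ = 0 := by rw [← lie_skew, hxy, neg_zero]
  by_cases hx : x ∈ L
  · by_cases hy : y ∈ L
    · have hz : c₁ • x + c₂ • y ∈ L := L.add_mem (L.smul_mem c₁ hx) (L.smul_mem c₂ hy)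
      simp [hx, hy, hz]
    · have hz := hzero y (c₁ • x + c₂ • y) hy (by simp [hyx])
      have hx0 := hzero y x hy hyx
      simp only [hz, hx0, if_neg hy, mul_zero, add_zero]
  · have hz := hzero x (c₁ • x + c₂ • y) hx (by simp [hxy])
    have hy0 := hzero x y hx hxy
    simp only [hz, hy0, if_neg hx, mul_zero, add_zero]
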